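/- Let (X, μ, E) be a properly ergodic mcp CBER of type III and let A ⊆ X be a non-null Borel set. Then (X, μ, E) is isomorphic to its restriction (A, μ|_A, E ∩ (A × A)): there is a Borel bijection f from a conull subset of X onto a conull subset of A such that f preserves the measure class (f_*μ is equivalent to μ|_A) and, for almost every x, y ∈ X, x E y if and only if f(x) E f(y). -/

import Mathlib

open MeasureTheory Set Filter
open scoped ENNReal ENat Topology

noncomputable section

variable {X : Type*}

/-- The integral of `f` over the set of edges `A` against the "left" measure `ν_l`
determined by `μ`:  `∫ₐ f dν_l = ∫ₓ Σ_{y : (x,y) ∈ A} f(x,y) dμ(x)`. -/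
def lintL [MeasurableSpace X] (μ : Measure X) (f : X × X → ℝ≥0∞) (A : Set (X × X)) : ℝ≥0∞ :=
  ∫⁻ x, ∑' y : {y : X // (x, y) ∈ A}, f (x, (y : X)) ∂μ

/-- The integral of `f` over the set of edges `A` against the "right" measure `ν_r`
determined by `μ`:  `∫ₐ f dν_r = ∫ₓ Σ_{y : (y,x) ∈ A} f(y,x) dμ(x)`. -/
def lintR [MeasurableSpace X] (μ : Measure X) (f : X × X → ℝ≥0∞) (A : Set (X × X)) : ℝ≥0∞ :=
  ∫⁻ x, ∑' y : {y : X // (y, x) ∈ A}, f ((y : X), x) ∂μ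

/-- `ν_l(A) = ∫ₓ |{y : (x,y) ∈ A}| dμ(x)`. -/
def nuL [MeasurableSpace X] (μ : Measure X) (A : Set (X × X)) : ℝ≥0∞ :=
  lintL μ (fun _ => 1) A

/-- `ν_r(A) = ∫ₓ |{y : (y,x) ∈ A}| dμ(x)`. -/
def nuR [MeasurableSpace X] (μ : Measure X) (A : Set (X × X)) : ℝ≥0∞ :=
  lintR μ (fun _ => 1) A

/-- `E` is measure-class-preserving w.r.t. `μ`: `ν_l` and `ν_r` are mutually absolutely
continuous on Borel subsets of `E`. -/
def MCP [MeasurableSpace X] (μ : Measure X) (E : Set (X × X)) : Prop :=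
  ∀ A : Set (X × X), A ⊆ E → MeasurableSet A → (nuL μ A = 0 ↔ nuR μ A = 0)

/-- `E` is measure-preserving w.r.t. `μ`: `ν_l = ν_r` on Borel subsets of `E`. -/
def MPrel [MeasurableSpace X] (μ : Measure X) (E : Set (X × X)) : Prop :=
  ∀ A : Set (X × X), A ⊆ E → MeasurableSet A → nuL μ A = nuR μ A

/-- A countable Borel equivalence relation: a Borel equivalence relation all of whose
classes are countable. -/
def IsCBER [MeasurableSpace X] (E : Set (X × X)) : Prop :=
  MeasurableSet E ∧ Equivalence (fun x y => (x, y) ∈ E) ∧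
    ∀ x : X, {y | (x, y) ∈ E}.Countable

/-- The `E`-saturation of a set `A`. -/
def ESat (E : Set (X × X)) (A : Set X) : Set X :=
  {x | ∃ y ∈ A, (x, y) ∈ E}

/-- `E` is ergodic w.r.t. `μ`: every non-null Borel set is a complete section. -/
def ErgodicRel [MeasurableSpace X] (μ : Measure X) (E : Set (X × X)) : Prop :=
  ∀ A : Set X, MeasurableSet A → μ A ≠ 0 → μ (ESat E A)ᶜ = 0

/-- `E` is properly ergodic: ergodic, and `μ` is not concentrated on a single `E`-class. -/
def ProperlyErgodicRel [MeasurableSpace X] (μ : Measure X) (E : Set (X × X)) : Prop :=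
  ErgodicRel μ E ∧ ∀ x : X, μ {y | (x, y) ∉ E} ≠ 0

/-- `μ'` is `E`-invariant: every Borel bijection between Borel subsets whose graph is
contained in `E` pushes the restricted measure forward to the restricted measure. -/
def InvariantUnder [MeasurableSpace X] (μ' : Measure X) (E : Set (X × X)) : Prop :=
  ∀ (f : X → X) (A : Set X), Measurable f → MeasurableSet A → Set.InjOn f A →
    (∀ x ∈ A, (x, f x) ∈ E) →
    Measure.map f (μ'.restrict A) = μ'.restrict (f '' A)

/-- Mutual absolute continuity of measures. -/
def EquivMeasure [MeasurableSpace X] (μ' μ : Measure X) : Prop :=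
  μ' ≪ μ ∧ μ ≪ μ'

/-- Type II: `μ` is non-atomic and some σ-finite measure equivalent to `μ` is `E`-invariant. -/
def IsTypeII [MeasurableSpace X] (μ : Measure X) (E : Set (X × X)) : Prop :=
  NoAtoms μ ∧
    ∃ μ' : Measure X, SigmaFinite μ' ∧ EquivMeasure μ' μ ∧ InvariantUnder μ' E

/-- Type III: no σ-finite measure equivalent to `μ` is `E`-invariant. -/
def IsTypeIII [MeasurableSpace X] (μ : Measure X) (E : Set (X × X)) : Prop :=
  ¬ ∃ μ' : Measure X, SigmaFinite μ' ∧ EquivMeasure μ' μ ∧ InvariantUnder μ' E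

/-- `w` is (a pointwise-cocycle version of) the Radon–Nikodym cocycle `𝔴 = dν_l/dν_r` of the
mcp relation `E`: it is Borel, takes values in `(0,∞)` on `E`, satisfies the cocycle identity,
and `ν_l(A) = ∫_A w dν_r` for every Borel `A ⊆ E`. -/
def IsRNCocycle [MeasurableSpace X] (μ : Measure X) (E : Set (X × X))
    (w : X × X → ℝ≥0∞) : Prop :=
  Measurable w ∧
  (∀ e ∈ E, w e ≠ 0 ∧ w e ≠ ∞) ∧
  (∀ x y z : X, (y, x) ∈ E → (z, y) ∈ E → w (z, y) * w (y, x) = w (z, x)) ∧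
  (∀ x : X, w (x, x) = 1) ∧
  ∀ A : Set (X × X), A ⊆ E → MeasurableSet A → nuL μ A = lintR μ w A

/-- The connectedness relation of a graph `G`: `x` and `y` are related iff they are joined
by a path of edges of `G`. -/
def connRel (G : Set (X × X)) : Set (X × X) :=
  {p | Relation.ReflTransGen (fun a b => (a, b) ∈ G) p.1 p.2}

/-- The symmetrization of a directed graph. -/
def symmCl (G : Set (X × X)) : Set (X × X) :=
  {p | p ∈ G ∨ (p.2, p.1) ∈ G}

/-- The graph distance in `G` (with value `⊤` between distinct components). -/
def gdist (G : Set (X × X)) (x y : X) : ℕ∞ :=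
  sInf ((fun m : ℕ => (m : ℕ∞)) ''
    {m : ℕ | ∃ c : ℕ → X, c 0 = x ∧ c m = y ∧ ∀ i < m, (c i, c (i + 1)) ∈ G})

/-- For a directed edge `(x,y)` of an acyclic graph `G`, the half-space
`N_{(x,y)} = {z : d_G(y,z) < d_G(x,z)}`. -/
def halfSpace (G : Set (X × X)) (x y : X) : Set X :=
  {z | gdist G y z < gdist G x z}

/-- A geodesic ray in `G`. -/
def IsGeodesicRay (G : Set (X × X)) (r : ℕ → X) : Prop :=
  (∀ i : ℕ, (r i, r (i + 1)) ∈ G) ∧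
    ∀ i j : ℕ, i ≤ j → gdist G (r i) (r j) = ((j - i : ℕ) : ℕ∞)

/-- The end represented by the geodesic ray `r` is vanishing w.r.t. the cocycle `w`:
`sup {w(y, r 0) : y ∈ N_{(r i, r (i+1))}} → 0` as `i → ∞`. -/
def VanishingEnd (w : X × X → ℝ≥0∞) (G : Set (X × X)) (r : ℕ → X) : Prop :=
  Tendsto (fun i : ℕ => ⨆ y ∈ halfSpace G (r i) (r (i + 1)), w (y, r 0))
    atTop (nhds 0)

/-- A (symmetric) graph is acyclic if it has no injective cycle of length `≥ 3`. -/
def AcyclicGraph (G : Set (X × X)) : Prop :=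
  ∀ (n : ℕ) (c : ℕ → X), 2 < n → (∀ i < n, (c i, c ((i + 1) % n)) ∈ G) →
    ¬ Function.Injective fun i : Fin n => c (i : ℕ)

/-- Amenability of a locally countable Borel graph `G` (w.r.t. the measure `μ`):
there are Borel a.e.-averaging functions `λ_n` on the connectedness relation of `G`. -/
def AmenableGraph [MeasurableSpace X] (μ : Measure X) (G : Set (X × X)) : Prop :=
  ∃ lam : ℕ → X × X → ℝ,
    (∀ n, Measurable (lam n)) ∧
    (∀ n e, 0 ≤ lam n e) ∧
    (∀ᵐ x ∂μ, ∀ n : ℕ, ∑' y : {y : X // (x, y) ∈ connRel G}, lam n (x, (y : X)) = 1) ∧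
    nuL μ {e ∈ G | ¬ Tendsto
        (fun n : ℕ => ∑' z : {z : X // (e.1, z) ∈ connRel G},
          |lam n (e.1, (z : X)) - lam n (e.2, (z : X))|)
        atTop (nhds 0)} = 0

/-- The Schreier graph of an action of a free group, with respect to the free basis. -/
def schreier {ι : Type*} [MeasurableSpace X] (φ : FreeGroup ι →* Equiv.Perm X) :
    Set (X × X) :=
  {p | p.1 ≠ p.2 ∧ ∃ s : ι,
    φ (FreeGroup.of s) p.1 = p.2 ∨ φ (FreeGroup.of s) p.2 = p.1}

theorem analytic_inner {Y : Type*} [TopologicalSpace Y] [PolishSpace Y] [MeasurableSpace Y]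
    [BorelSpace Y] (μ : Measure Y) [IsFiniteMeasure μ] (f : (ℕ → ℕ) → Y) (hf : Continuous f)
    (c : ℝ≥0∞) (hc : c < μ (range f)) :
    ∃ K : Set Y, IsCompact K ∧ K ⊆ range f ∧ c ≤ μ K := by
  have step : ∀ (k : ℕ) (S : {S : Set (ℕ → ℕ) // c < μ (f '' S)}),
      ∃ m : ℕ, c < μ (f '' (S.1 ∩ {x | x k ≤ m})) := by
    rintro k ⟨S, hS⟩
    have h1 : f '' S = ⋃ m : ℕ, f '' (S ∩ {x | x k ≤ m}) := by
      rw [← image_iUnion, ← inter_iUnion]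
      congr 1
      ext x
      simp only [mem_inter_iff, mem_iUnion, mem_ofPred_eq]
      exact ⟨fun h => ⟨h, x k, le_rfl⟩, fun h => h.1⟩
    have h2 : Monotone fun m : ℕ => f '' (S ∩ {x | x k ≤ m}) := by
      intro a b hab
      apply image_mono
      rintro x ⟨hx, hx2⟩
      exact ⟨hx, le_trans hx2 hab⟩
    rw [h1, h2.measure_iUnion, lt_iSup_iff] at hS
    exact hS
  choose m hm using step
  let T : ℕ → {S : Set (ℕ → ℕ) // c < μ (f '' S)} := fun k =>
    Nat.rec ⟨univ, by simpa using hc⟩ (fun k S => ⟨S.1 ∩ {x | x k ≤ m k S}, hm k S⟩) k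
  let n : ℕ → ℕ := fun k => m k (T k)
  have hT : ∀ k x, x ∈ (T k).1 ↔ ∀ i < k, x i ≤ n i := by
    intro k
    induction k with
    | zero => intro x; simp [T]
    | succ k ih =>
      intro x
      have : (T (k+1)).1 = (T k).1 ∩ {x | x k ≤ n k} := rfl
      rw [this, mem_inter_iff, ih]
      constructor
      · rintro ⟨h1, h2⟩ i hi
        rcases Nat.lt_succ_iff_lt_or_eq.1 hi with h | h
        · exact h1 i h
        · subst h; exact h2
      · intro h
        exact ⟨fun i hi => h i (by omega), h k (by omega)⟩
  let K : Set (ℕ → ℕ) := univ.pi fun i => Iic (n i)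
  have hK : IsCompact K := isCompact_univ_pi fun i => (finite_Iic (n i)).isCompact
  refine ⟨f '' K, hK.image hf, image_subset_range _ _, ?_⟩
  by_contra hlt
  push Not at hlt
  obtain ⟨U, hKU, hU, hUc⟩ := Set.exists_isOpen_lt_of_lt _ _ hlt
  have key : ∃ k, (T k).1 ⊆ f ⁻¹' U := by
    by_contra hno
    push Not at hno
    have : ∀ k, ∃ x ∈ (T k).1, x ∉ f ⁻¹' U := fun k => not_subset.1 (hno k)
    choose x hx hxU using this
    let K2 : Set (ℕ → ℕ) := univ.pi fun i => Iic (n i + ∑ j ∈ Finset.range (i+1), x j i)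
    have hK2 : IsCompact K2 := isCompact_univ_pi fun i => (finite_Iic _).isCompact
    have hxK2 : ∀ k, x k ∈ K2 := by
      intro k i _
      simp only [mem_Iic]
      by_cases h : i < k
      · have := (hT k (x k)).1 (hx k) i h
        omega
      · have : x k i ≤ ∑ j ∈ Finset.range (i+1), x j i :=
          Finset.single_le_sum (f := fun j => x j i) (fun _ _ => Nat.zero_le _)
            (Finset.mem_range.2 (by omega))
        omega
    obtain ⟨a, -, φ, hφ, hlim⟩ := hK2.tendsto_subseq hxK2
    have haU : a ∈ (f ⁻¹' U)ᶜ :=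
      (hU.preimage hf).isClosed_compl.mem_of_tendsto hlim (Eventually.of_forall fun k => hxU _)
    apply haU
    apply hKU
    refine mem_image_of_mem f ?_
    intro i _
    have h1 : Tendsto (fun k => x (φ k) i) atTop (𝓝 (a i)) := (tendsto_pi_nhds.1 hlim) i
    refine isClosed_Iic.mem_of_tendsto h1 ?_
    filter_upwards [eventually_gt_atTop i] with k hk
    exact (hT _ _).1 (hx (φ k)) i (lt_of_lt_of_le hk (hφ.id_le k))
  obtain ⟨k, hk⟩ := key
  have h1 : c < μ (f '' (T k).1) := (T k).2
  have h2 : μ (f '' (T k).1) ≤ μ U := measure_mono (image_subset_iff.2 hk)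
  exact absurd (h1.trans_le h2) (not_lt.2 hUc.le)

theorem analytic_nullMeasurable {Y : Type*} [TopologicalSpace Y] [PolishSpace Y] [MeasurableSpace Y]
    [BorelSpace Y] (μ : Measure Y) [IsFiniteMeasure μ] (s : Set Y) (hs : AnalyticSet s) :
    NullMeasurableSet s μ := by
  rw [AnalyticSet] at hs
  rcases hs with rfl | ⟨f, hf, rfl⟩
  · exact MeasurableSet.empty.nullMeasurableSet
  by_cases h0 : μ (range f) = 0
  · exact NullMeasurableSet.of_null h0
  obtain ⟨u, -, hu, hul⟩ := exists_seq_strictMono_tendsto' (pos_iff_ne_zero.2 h0)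
  choose K hK hKs hKc using fun n => analytic_inner μ f hf (u n) (hu n).2
  have hsub : (⋃ n, K n) ⊆ range f := iUnion_subset hKs
  have hmeas : MeasurableSet (⋃ n, K n) := MeasurableSet.iUnion fun n => (hK n).measurableSet
  have hge : μ (range f) ≤ μ (⋃ n, K n) :=
    le_of_tendsto' hul fun n => (hKc n).trans (measure_mono (subset_iUnion _ _))
  have := ae_eq_of_subset_of_measure_ge hsub hge hmeas.nullMeasurableSet (measure_ne_top _ _)
  exact hmeas.nullMeasurableSet.congr this

theorem image_nullMeasurable {F Y : Type*} [MeasurableSpace F] [StandardBorelSpace F]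
    [MeasurableSpace Y] [StandardBorelSpace Y] (μ : Measure Y) [IsFiniteMeasure μ]
    (p : F → Y) (hp : Measurable p) (s : Set F) (hs : MeasurableSet s) :
    NullMeasurableSet (p '' s) μ := by
  let _ := upgradeStandardBorel Y
  exact analytic_nullMeasurable μ _ (hs.analyticSet_image hp)

theorem exhaust {Y : Type*} [MeasurableSpace Y] (μ : Measure Y) [IsFiniteMeasure μ]
    (P : Set Y → Prop) (h0 : P ∅) (hU : ∀ H : ℕ → Set Y, (∀ n, P (H n)) → P (⋃ n, H n))
    (hm : ∀ H, P H → MeasurableSet H) :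
    ∃ H, P H ∧ ∀ Q, P Q → μ (Q \ H) = 0 := by
  obtain ⟨u, -, hu, huS⟩ := exists_seq_tendsto_sSup (S := μ '' {H | P H}) ⟨_, ∅, h0, rfl⟩
    (OrderTop.bddAbove _)
  choose H hH hHu using huS
  refine ⟨⋃ n, H n, hU H hH, fun Q hQ => ?_⟩
  have h1 : sSup (μ '' {H | P H}) ≤ μ (⋃ n, H n) :=
    le_of_tendsto' hu fun n => (hHu n) ▸ measure_mono (subset_iUnion _ _)
  have h2 : P (Q ∪ ⋃ n, H n) := by
    have := hU (fun n => Nat.casesOn n Q H) (fun n => by cases n; exacts [hQ, hH _])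
    convert this using 1
    ext x
    simp only [mem_union, mem_iUnion]
    constructor
    · rintro (h | ⟨n, h⟩)
      exacts [⟨0, h⟩, ⟨n+1, h⟩]
    · rintro ⟨n, h⟩
      cases n
      exacts [Or.inl h, Or.inr ⟨_, h⟩]
  have h3 : μ (Q ∪ ⋃ n, H n) ≤ μ (⋃ n, H n) := (le_sSup (mem_image_of_mem μ (show (Q ∪ ⋃ n, H n) ∈ {H | P H} from h2))).trans h1
  have h4 := measure_union (μ := μ) (disjoint_sdiff_self_left : Disjoint (Q \ ⋃ n, H n) (⋃ n, H n))
    (hm _ (hU H hH))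
  rw [sdiff_union_self] at h4
  rw [h4] at h3
  have h5 : μ (Q \ ⋃ n, H n) + μ (⋃ n, H n) ≤ 0 + μ (⋃ n, H n) := by simpa using h3
  exact le_antisymm ((ENNReal.add_le_add_iff_right (measure_ne_top _ _)).1 h5) (zero_le)

/-- `B` is covered by countably many Borel partial sections up to a set with null image. -/
def Cov {F Y : Type*} [MeasurableSpace F] [MeasurableSpace Y] (μ : Measure Y) (p : F → Y)
    (B : Set F) : Prop :=
  ∃ C : ℕ → Set F, (∀ n, MeasurableSet (C n)) ∧ (∀ n, InjOn p (C n)) ∧ μ (p '' (B \ ⋃ n, C n)) = 0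

theorem Cov.mono {F Y : Type*} [MeasurableSpace F] [MeasurableSpace Y] {μ : Measure Y} {p : F → Y}
    {B B' : Set F} (h : Cov μ p B) (hB : B' ⊆ B) : Cov μ p B' := by
  obtain ⟨C, h1, h2, h3⟩ := h
  exact ⟨C, h1, h2, measure_mono_null (image_mono (sdiff_subset_sdiff_left hB)) h3⟩

theorem Cov.iUnion {F Y : Type*} [MeasurableSpace F] [MeasurableSpace Y] {μ : Measure Y} {p : F → Y}
    {B : ℕ → Set F} (h : ∀ n, Cov μ p (B n)) : Cov μ p (⋃ n, B n) := by
  choose C h1 h2 h3 using h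
  refine ⟨fun k => C k.unpair.1 k.unpair.2, fun _ => h1 _ _, fun _ => h2 _ _, ?_⟩
  refine measure_mono_null ?_ (measure_iUnion_null h3)
  rw [← image_iUnion]
  apply image_mono
  rintro x ⟨hx, hx2⟩
  obtain ⟨n, hn⟩ := mem_iUnion.1 hx
  refine mem_iUnion.2 ⟨n, hn, fun hc => hx2 ?_⟩
  obtain ⟨m, hm⟩ := mem_iUnion.1 hc
  exact mem_iUnion.2 ⟨Nat.pair n m, by simpa using hm⟩

theorem Cov.union {F Y : Type*} [MeasurableSpace F] [MeasurableSpace Y] {μ : Measure Y} {p : F → Y}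
    {B B' : Set F} (h : Cov μ p B) (h' : Cov μ p B') : Cov μ p (B ∪ B') := by
  have := Cov.iUnion (B := fun n => Nat.casesOn n B (fun _ => B'))
    (fun n => by cases n; exacts [h, h'])
  refine this.mono ?_
  rintro x (hx | hx)
  exacts [mem_iUnion.2 ⟨0, hx⟩, mem_iUnion.2 ⟨1, hx⟩]

theorem Cov.of_injOn {F Y : Type*} [MeasurableSpace F] [MeasurableSpace Y] {μ : Measure Y}
    {p : F → Y} {B : Set F} (hB : MeasurableSet B) (h : InjOn p B) : Cov μ p B :=
  ⟨fun _ => B, fun _ => hB, fun _ => h, by simp [iUnion_const]⟩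

theorem Cov.of_null {F Y : Type*} [MeasurableSpace F] [MeasurableSpace Y] {μ : Measure Y}
    {p : F → Y} {B : Set F} (h : μ (p '' B) = 0) : Cov μ p B :=
  ⟨fun _ => ∅, fun _ => MeasurableSet.empty, fun _ => injOn_empty _, by simpa using h⟩

theorem exists_isolated {F : Type*} [TopologicalSpace F] [PolishSpace F] (K : Set F)
    (hK : IsClosed K) (hc : K.Countable) (hne : K.Nonempty) :
    ∃ x ∈ K, ∃ U : Set F, IsOpen U ∧ x ∈ U ∧ K ∩ U ⊆ {x} := by
  have : PolishSpace K := hK.polishSpace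
  have : Countable K := hc.to_subtype
  have : Nonempty K := hne.to_subtype
  let _ := TopologicalSpace.upgradeIsCompletelyMetrizable K
  obtain ⟨x, hx⟩ := nonempty_interior_of_iUnion_of_closed (X := K) (f := fun x : K => {x})
    (fun x => isClosed_singleton) (iUnion_of_singleton K)
  obtain ⟨y, hy⟩ := hx
  have hyx : y = x := mem_singleton_iff.1 (interior_subset hy)
  subst hyx
  obtain ⟨U, hU, hUe⟩ := isOpen_induced_iff.1 (isOpen_interior (s := ({y} : Set K)))
  refine ⟨y, y.2, U, hU, ?_, ?_⟩
  · have : y ∈ Subtype.val ⁻¹' U := hUe ▸ hy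
    exact this
  · rintro z ⟨hz, hzU⟩
    have : (⟨z, hz⟩ : K) ∈ interior ({y} : Set K) := hUe ▸ (show (⟨z, hz⟩ : K) ∈ Subtype.val ⁻¹' U from hzU)
    have := interior_subset this
    rw [mem_singleton_iff] at this ⊢
    rw [← this]

theorem LN_top {F Y : Type*} [TopologicalSpace F] [PolishSpace F] [MeasurableSpace F] [BorelSpace F]
    [TopologicalSpace Y] [PolishSpace Y] [MeasurableSpace Y] [BorelSpace Y]
    (μ : Measure Y) [IsFiniteMeasure μ] (p : F → Y) (hp : Continuous p)
    (hc : ∀ y, (p ⁻¹' {y}).Countable) : Cov μ p univ := by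
  obtain ⟨b, hbc, -, hb⟩ := TopologicalSpace.exists_countable_basis F
  by_cases hbne : b.Nonempty
  swap
  · have hbe := not_nonempty_iff_eq_empty.1 hbne
    have : (univ : Set F) = ∅ := by
      rw [← hb.sUnion_eq, hbe, sUnion_empty]
    rw [this]
    exact Cov.of_null (by simp)
  obtain ⟨W, hW⟩ := hbc.exists_eq_range hbne
  have hWo : ∀ n, IsOpen (W n) := fun n => hb.isOpen (hW ▸ mem_range_self n)
  have hWb : ∀ (x : F) (U : Set F), IsOpen U → x ∈ U → ∃ n, x ∈ W n ∧ W n ⊆ U := by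
    intro x U hU hx
    obtain ⟨v, hv, hxv, hvU⟩ := hb.exists_subset_of_mem_open hx hU
    rw [hW] at hv
    obtain ⟨n, rfl⟩ := hv
    exact ⟨n, hxv, hvU⟩
  have hex : ∀ n, ∃ H, (MeasurableSet H ∧ Cov μ p (W n ∩ p ⁻¹' H)) ∧
      ∀ Q, (MeasurableSet Q ∧ Cov μ p (W n ∩ p ⁻¹' Q)) → μ (Q \ H) = 0 := by
    intro n
    apply exhaust
    · exact ⟨MeasurableSet.empty, Cov.of_null (by simp)⟩
    · intro H hH
      refine ⟨MeasurableSet.iUnion fun n => (hH n).1, ?_⟩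
      rw [preimage_iUnion, inter_iUnion]
      exact Cov.iUnion fun n => (hH n).2
    · exact fun H h => h.1
  choose H hH hHmax using hex
  have hpm : Measurable p := hp.measurable
  set F' : Set F := (⋃ n, W n ∩ p ⁻¹' (H n))ᶜ with hF'
  have hF'c : Cov μ p F'ᶜ := by
    rw [hF', compl_compl]
    exact Cov.iUnion fun n => (hH n).2
  have hF'm : MeasurableSet F' :=
    (MeasurableSet.iUnion fun n => (hWo n).measurableSet.inter (hpm (hH n).1)).compl
  -- points with a unique preimage in `W n ∩ F'`
  let M : ℕ → Set Y := fun n => ⋃ i, ⋃ j, ⋃ _ : Disjoint (W i) (W j),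
    (p '' (F' ∩ W n ∩ W i)) ∩ (p '' (F' ∩ W n ∩ W j))
  have him : ∀ s, MeasurableSet s → NullMeasurableSet (p '' s) μ := fun s hs =>
    analytic_nullMeasurable μ _ (hs.analyticSet_image hpm)
  have hMm : ∀ n, NullMeasurableSet (M n) μ := by
    intro n
    refine NullMeasurableSet.iUnion fun i => NullMeasurableSet.iUnion fun j =>
      NullMeasurableSet.iUnion fun _ => ?_
    exact (him _ ((hF'm.inter (hWo n).measurableSet).inter (hWo i).measurableSet)).inter
      (him _ ((hF'm.inter (hWo n).measurableSet).inter (hWo j).measurableSet))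
  let Q : ℕ → Set Y := fun n => p '' (F' ∩ W n) \ M n
  have hQm : ∀ n, NullMeasurableSet (Q n) μ := fun n =>
    (him _ (hF'm.inter (hWo n).measurableSet)).diff (hMm n)
  have hQ0 : ∀ n, μ (Q n) = 0 := by
    intro n
    obtain ⟨Q', hQ's, hQ'm, hQ'e⟩ := (hQm n).exists_measurable_subset_ae_eq
    rw [← measure_congr hQ'e]
    have hinj : InjOn p (F' ∩ W n ∩ p ⁻¹' Q') := by
      rintro x ⟨hx, hxQ⟩ y ⟨hy, hyQ⟩ hxy
      by_contra hne
      obtain ⟨U, V, hU, hV, hxU, hyV, hUV⟩ := t2_separation hne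
      obtain ⟨i, hi, hiU⟩ := hWb x U hU hxU
      obtain ⟨j, hj, hjV⟩ := hWb y V hV hyV
      apply (hQ's hxQ).2
      refine mem_iUnion.2 ⟨i, mem_iUnion.2 ⟨j, mem_iUnion.2 ⟨hUV.mono hiU hjV, ?_⟩⟩⟩
      exact ⟨⟨x, ⟨hx, hi⟩, rfl⟩, ⟨y, ⟨hy, hj⟩, hxy.symm⟩⟩
    have hcov : Cov μ p (W n ∩ p ⁻¹' Q') := by
      refine ((Cov.of_injOn ?_ hinj).union hF'c).mono ?_
      · exact (hF'm.inter (hWo n).measurableSet).inter (hpm hQ'm)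
      · rintro x ⟨hx, hxQ⟩
        by_cases h : x ∈ F'
        exacts [Or.inl ⟨⟨h, hx⟩, hxQ⟩, Or.inr h]
    have := hHmax n Q' ⟨hQ'm, hcov⟩
    have hd : Q' \ H n = Q' := by
      refine sdiff_eq_left.2 (disjoint_left.2 fun z hz hzH => ?_)
      obtain ⟨x, ⟨hx, hxW⟩, rfl⟩ := (hQ's hz).1
      exact hx (mem_iUnion.2 ⟨n, hxW, hzH⟩)
    rwa [hd] at this
  have hF'0 : μ (p '' F') = 0 := by
    refine measure_mono_null ?_ (measure_iUnion_null hQ0)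
    rintro z ⟨x0, hx0, hz⟩
    let K : Set F := p ⁻¹' {z} ∩ ⋂ n, ⋂ _ : z ∈ H n, (W n)ᶜ
    have hKF : ∀ x, x ∈ K ↔ p x = z ∧ x ∈ F' := by
      intro x
      simp only [K, hF', mem_inter_iff, mem_preimage, mem_singleton_iff, mem_iInter, mem_compl_iff,
        mem_iUnion, not_exists, not_and]
      constructor
      · rintro ⟨rfl, h⟩
        exact ⟨rfl, fun n hn hH => h n hH hn⟩
      · rintro ⟨rfl, h⟩
        exact ⟨rfl, fun n hn hH => h n hH hn⟩
    have hKc : IsClosed K := (isClosed_singleton.preimage hp).inter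
      (isClosed_iInter fun n => isClosed_iInter fun _ => (hWo n).isClosed_compl)
    obtain ⟨x, hx, U, hU, hxU, hKU⟩ := exists_isolated K hKc
      ((hc z).mono inter_subset_left) ⟨x0, (hKF _).2 ⟨hz, hx0⟩⟩
    obtain ⟨n, hn, hnU⟩ := hWb x U hU hxU
    have hx' := (hKF x).1 hx
    refine mem_iUnion.2 ⟨n, ⟨x, ⟨hx'.2, hn⟩, hx'.1⟩, ?_⟩
    intro hM
    simp only [M, mem_iUnion] at hM
    obtain ⟨i, j, hij, ⟨y, ⟨⟨hy, hyn⟩, hyi⟩, hyz⟩, ⟨y', ⟨⟨hy', hyn'⟩, hyi'⟩, hyz'⟩⟩ := hM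
    have e1 : y = x := hKU ⟨(hKF _).2 ⟨hyz, hy⟩, hnU hyn⟩
    have e2 : y' = x := hKU ⟨(hKF _).2 ⟨hyz', hy'⟩, hnU hyn'⟩
    rw [e1] at hyi
    rw [e2] at hyi'
    exact disjoint_left.1 hij hyi hyi'
  exact ((Cov.of_null hF'0).union hF'c).mono (by rw [union_compl_self])

theorem LN {F Y : Type*} [MeasurableSpace F] [StandardBorelSpace F]
    [MeasurableSpace Y] [StandardBorelSpace Y]
    (μ : Measure Y) [IsFiniteMeasure μ] (p : F → Y) (hp : Measurable p)
    (hc : ∀ y, (p ⁻¹' {y}).Countable) : Cov μ p univ := by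
  let _ := upgradeStandardBorel Y
  let tF := upgradeStandardBorel F
  have hbor := BorelSpace.measurable_eq (α := F)
  have hpolF : PolishSpace F := inferInstance
  obtain ⟨t', ht', hcont, hpol⟩ := hp.exists_continuous
  have hB : @BorelSpace F t' _ := by
    refine @BorelSpace.mk F t' _ ?_
    exact hbor.trans (MeasureTheory.borel_eq_borel_of_le hpol hpolF ht').symm
  exact @LN_top F Y t' hpol _ hB _ _ _ _ μ _ p hcont hc

theorem esat_nullMeasurable [MeasurableSpace X] [StandardBorelSpace X] (μ : Measure X)
    [SigmaFinite μ] (E : Set (X × X)) (hE : MeasurableSet E) (N : Set X) (hN : MeasurableSet N) :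
    NullMeasurableSet (ESat E N) μ := by
  have h1 : ESat E N = Prod.fst '' (E ∩ Prod.snd ⁻¹' N) := by
    ext x
    constructor
    · rintro ⟨y, hy, hxy⟩
      exact ⟨(x, y), ⟨hxy, hy⟩, rfl⟩
    · rintro ⟨⟨x', y⟩, ⟨h1, h2⟩, rfl⟩
      exact ⟨y, h2, h1⟩
  rw [h1]
  have := image_nullMeasurable μ.toFinite (Prod.fst : X × X → X) measurable_fst _
    (hE.inter (measurable_snd hN))
  exact this.mono_ac (absolutelyContinuous_toFinite μ)

theorem esat_null [MeasurableSpace X] [StandardBorelSpace X] (μ : Measure X)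
    [SigmaFinite μ] (E : Set (X × X)) (hE : MeasurableSet E) (hmcp : MCP μ E) (N : Set X)
    (hN0 : μ N = 0) : μ (ESat E N) = 0 := by
  suffices H : ∀ N, MeasurableSet N → μ N = 0 → μ (ESat E N) = 0 by
    refine measure_mono_null ?_ (H (toMeasurable μ N) (measurableSet_toMeasurable _ _)
      (by rwa [measure_toMeasurable]))
    rintro x ⟨y, hy, hxy⟩
    exact ⟨y, subset_toMeasurable _ _ hy, hxy⟩
  clear hN0 N
  intro N hN hN0
  obtain ⟨S, hSs, hSm, hSe⟩ := (esat_nullMeasurable μ E hE N hN).exists_measurable_subset_ae_eq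
  rw [← measure_congr hSe]
  have hB : nuR μ (E ∩ Prod.snd ⁻¹' N) = 0 := by
    unfold nuR lintR
    refine lintegral_eq_zero_of_ae_eq_zero ?_
    filter_upwards [measure_eq_zero_iff_ae_notMem.1 hN0] with x hx
    have : IsEmpty {y : X // (y, x) ∈ E ∩ Prod.snd ⁻¹' N} := ⟨fun y => hx y.2.2⟩
    simp
  rw [← hmcp _ inter_subset_left (hE.inter (measurable_snd hN))] at hB
  unfold nuL lintL at hB
  rw [← nonpos_iff_eq_zero, ← hB, ← lintegral_indicator_one hSm]
  refine lintegral_mono fun x => ?_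
  by_cases hx : x ∈ S
  · obtain ⟨y, hy, hxy⟩ := hSs hx
    rw [indicator_of_mem hx]
    exact ENNReal.le_tsum (f := fun _ : {y : X // (x, y) ∈ E ∩ Prod.snd ⁻¹' N} => (1 : ℝ≥0∞)) ⟨y, hxy, hy⟩
  · rw [indicator_of_notMem hx]; exact zero_le

theorem null_inv [MeasurableSpace X] (μ : Measure X) (E : Set (X × X))
    (hnull : ∀ N, μ N = 0 → μ (ESat E N) = 0) 
    (N : Set X) (hN : μ N = 0) :
    ∃ Z : Set X, MeasurableSet Z ∧ μ Zᶜ = 0 ∧ (∀ x ∈ Z, x ∉ N) ∧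
      ∀ x y, x ∈ Z → (x, y) ∈ E → y ∈ Z := by
  let T : ℕ → Set X := fun k => Nat.rec (toMeasurable μ N)
    (fun _ S => toMeasurable μ (ESat E S)) k
  have hTm : ∀ k, MeasurableSet (T k) := by
    intro k; cases k <;> exact measurableSet_toMeasurable _ _
  have hT0 : ∀ k, μ (T k) = 0 := by
    intro k
    induction k with
    | zero => exact (measure_toMeasurable _).trans hN
    | succ k ih => exact (measure_toMeasurable _).trans (hnull _ ih)
  refine ⟨(⋃ k, T k)ᶜ, (MeasurableSet.iUnion hTm).compl, ?_, ?_, ?_⟩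
  · rw [compl_compl]; exact measure_iUnion_null hT0
  · intro x hx hxN
    exact hx (mem_iUnion.2 ⟨0, subset_toMeasurable _ _ hxN⟩)
  · intro x y hx hxy hy
    obtain ⟨k, hk⟩ := mem_iUnion.1 hy
    exact hx (mem_iUnion.2 ⟨k + 1, subset_toMeasurable _ _ ⟨y, hk, hxy⟩⟩)

theorem gen_exists [MeasurableSpace X] [StandardBorelSpace X] (μ : Measure X) [IsFiniteMeasure μ]
    (E : Set (X × X)) (hE : IsCBER E) :
    ∃ f : ℕ → X → X, (∀ n, Measurable (f n)) ∧ (∀ n x, (x, f n x) ∈ E) ∧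
      μ {x | ¬ ∀ y, (x, y) ∈ E → ∃ n, f n x = y} = 0 := by
  have : StandardBorelSpace E := hE.1.standardBorel
  let p : E → X := fun e => e.1.1
  have hp : Measurable p := measurable_fst.comp measurable_subtype_coe
  have hq : Measurable (fun e : E => e.1.2) := measurable_snd.comp measurable_subtype_coe
  have hc : ∀ y, (p ⁻¹' {y}).Countable := by
    intro y
    refine MapsTo.countable_of_injOn (f := fun e : E => e.1.2) (t := {z | (y, z) ∈ E}) ?_ ?_ (hE.2.2 y)
    · rintro ⟨⟨a, b⟩, h⟩ (rfl : a = y)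
      exact h
    · rintro ⟨⟨a, b⟩, h⟩ (rfl : a = y) ⟨⟨a', b'⟩, h'⟩ (rfl : a' = a) (hbb : b = b')
      subst hbb; rfl
  obtain ⟨C, hCm, hCi, hC0⟩ := LN μ p hp hc
  have hex : ∀ n, ∃ f : X → X, Measurable f ∧ (∀ x, (x, f x) ∈ E) ∧ ∀ e ∈ C n, f e.1.1 = e.1.2 := by
    intro n
    have : StandardBorelSpace (C n) := (hCm n).standardBorel
    have hem : MeasurableEmbedding (fun e : C n => p e.1) :=
      (hp.comp measurable_subtype_coe).measurableEmbedding
        (fun a b hab => Subtype.ext (hCi n a.2 b.2 hab))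
    obtain ⟨g, hg, hge⟩ := hem.exists_measurable_extend
      (hq.comp (measurable_subtype_coe (p := fun e => e ∈ C n))) (fun x => ⟨x⟩)
    have hge' : ∀ e ∈ C n, g e.1.1 = e.1.2 := fun e he => congrFun hge ⟨e, he⟩
    classical
    have hm : MeasurableSet (p '' C n) := (hCm n).image_of_measurable_injOn hp (hCi n)
    refine ⟨(p '' C n).piecewise g id, hg.piecewise hm measurable_id, ?_, ?_⟩
    · intro x
      by_cases hx : x ∈ p '' C n
      · rw [piecewise_eq_of_mem _ _ _ hx]
        obtain ⟨e, he, rfl⟩ := hx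
        change (e.1.1, g e.1.1) ∈ E
        rw [hge' e he]
        exact e.2
      · rw [piecewise_eq_of_notMem _ _ _ hx]
        exact hE.2.1.refl x
    · intro e he
      have hx : e.1.1 ∈ p '' C n := ⟨e, he, rfl⟩
      rw [piecewise_eq_of_mem _ _ _ hx, hge' e he]
  choose f hf hfE hfC using hex
  refine ⟨f, hf, hfE, measure_mono_null ?_ hC0⟩
  intro x hx
  simp only [mem_ofPred_eq, not_forall] at hx
  obtain ⟨y, hxy, hn⟩ := hx
  refine ⟨⟨(x, y), hxy⟩, ⟨mem_univ _, fun h => hn ?_⟩, rfl⟩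
  obtain ⟨n, h⟩ := mem_iUnion.1 h
  exact ⟨n, hfC n _ h⟩

/-- A system of countably many Borel partial injections generating `E` on an invariant conull
Borel set `Z`. -/
structure Sys [MeasurableSpace X] (μ : Measure X) (E : Set (X × X)) (g h : ℕ → X → X) (Z : Set X) :
    Prop where
  eqv : Equivalence (fun x y => (x, y) ∈ E)
  null : ∀ N, μ N = 0 → μ (ESat E N) = 0
  gm : ∀ k, Measurable (g k)
  hm : ∀ k, Measurable (h k)
  gE : ∀ k x, (x, g k x) ∈ E
  hE : ∀ k x, (x, h k x) ∈ E
  Zm : MeasurableSet Z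
  Z0 : μ Zᶜ = 0
  Zinv : ∀ x y, x ∈ Z → (x, y) ∈ E → y ∈ Z
  cover : ∀ x ∈ Z, ∀ y, (x, y) ∈ E → ∃ k, g k x = y ∧ h k y = x

theorem sys_exists [MeasurableSpace X] [StandardBorelSpace X] (μ : Measure X) [IsFiniteMeasure μ]
    (E : Set (X × X)) (hE : IsCBER E) (hnull : ∀ N, μ N = 0 → μ (ESat E N) = 0) :
    ∃ g h Z, Sys μ E g h Z := by
  obtain ⟨f, hf, hfE, hf0⟩ := gen_exists μ E hE
  obtain ⟨Z, hZm, hZ0, hZN, hZinv⟩ := null_inv μ E hnull _ hf0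
  refine ⟨fun k => f k.unpair.1, fun k => f k.unpair.2, Z, hE.2.1, hnull, fun _ => hf _,
    fun _ => hf _, fun _ => hfE _, fun _ => hfE _, hZm, hZ0, hZinv, ?_⟩
  intro x hx y hxy
  have h1 := hZN x hx
  have h2 := hZN y (hZinv x y hx hxy)
  simp only [mem_ofPred_eq, not_not] at h1 h2
  obtain ⟨n, hn⟩ := h1 y hxy
  obtain ⟨m, hm⟩ := h2 x (hE.2.1.symm hxy)
  exact ⟨Nat.pair n m, by simpa using hn, by simpa using hm⟩

/-- The Radon-Nikodym weight of the partial injection `g` with partial inverse `h`. -/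
def wf [MeasurableSpace X] (μ : Measure X) (g h : X → X) : X → ℝ≥0∞ :=
  ((μ.restrict {y | g (h y) = y}).map h).rnDeriv μ

theorem wf_meas [MeasurableSpace X] (μ : Measure X) (g h : X → X) : Measurable (wf μ g h) :=
  Measure.measurable_rnDeriv _ _

theorem wf_lint [MeasurableSpace X] [StandardBorelSpace X] (μ : Measure X) [IsFiniteMeasure μ]
    (E : Set (X × X))
    (hnull : ∀ N, μ N = 0 → μ (ESat E N) = 0)
    (g h : X → X) (hg : Measurable g) (hh : Measurable h) (hhE : ∀ x, (x, h x) ∈ E)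
    (S : Set X) (hS : MeasurableSet S) (u : X → ℝ≥0∞) (hu : Measurable u) :
    ∫⁻ x in S, u (g x) * wf μ g h x ∂μ = ∫⁻ y in {y | g (h y) = y} ∩ h ⁻¹' S, u y ∂μ := by
  have hR : MeasurableSet {y | g (h y) = y} := measurableSet_eq_fun (hg.comp hh) measurable_id
  have hac : (μ.restrict {y | g (h y) = y}).map h ≪ μ := by
    refine Measure.AbsolutelyContinuous.mk fun N hN hN0 => ?_
    rw [Measure.map_apply hh hN, Measure.restrict_apply (hh hN)]
    refine measure_mono_null ?_ (hnull N hN0)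
    rintro x ⟨hx, -⟩
    exact ⟨h x, hx, hhE x⟩
  have hind : Measurable (S.indicator fun x => u (g x)) := (hu.comp hg).indicator hS
  calc ∫⁻ x in S, u (g x) * wf μ g h x ∂μ
      = ∫⁻ x, wf μ g h x * S.indicator (fun x => u (g x)) x ∂μ := by
        rw [← lintegral_indicator hS]
        refine lintegral_congr fun x => ?_
        by_cases hx : x ∈ S <;> simp [hx, mul_comm]
    _ = ∫⁻ x, S.indicator (fun x => u (g x)) x ∂((μ.restrict {y | g (h y) = y}).map h) :=
        lintegral_rnDeriv_mul hac hind.aemeasurable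
    _ = ∫⁻ y in {y | g (h y) = y}, S.indicator (fun x => u (g x)) (h y) ∂μ := lintegral_map hind hh
    _ = ∫⁻ y in {y | g (h y) = y}, (h ⁻¹' S).indicator u y ∂μ := by
        refine setLIntegral_congr_fun hR fun y hy => ?_
        have hy' : g (h y) = y := hy
        by_cases hx : h y ∈ S
        · simp [indicator, hx, hy']
        · simp [indicator, hx]
    _ = _ := by
        rw [setLIntegral_indicator (hh hS), inter_comm]

theorem Sys.lint [MeasurableSpace X] [StandardBorelSpace X] {μ : Measure X} [IsFiniteMeasure μ]
    {E : Set (X × X)} {g h : ℕ → X → X} {Z : Set X} (H : Sys μ E g h Z) (k : ℕ)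
    {S : Set X} (hS : MeasurableSet S) {u : X → ℝ≥0∞} (hu : Measurable u) :
    ∫⁻ x in S, u (g k x) * wf μ (g k) (h k) x ∂μ
      = ∫⁻ y in {y | g k (h k y) = y} ∩ h k ⁻¹' S, u y ∂μ :=
  wf_lint μ E H.null _ _ (H.gm k) (H.hm k) (H.hE k) S hS u hu

theorem Sys.lint_one [MeasurableSpace X] [StandardBorelSpace X] {μ : Measure X} [IsFiniteMeasure μ]
    {E : Set (X × X)} {g h : ℕ → X → X} {Z : Set X} (H : Sys μ E g h Z) (k : ℕ)
    {S : Set X} (hS : MeasurableSet S) :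
    ∫⁻ x in S, wf μ (g k) (h k) x ∂μ = μ ({y | g k (h k y) = y} ∩ h k ⁻¹' S) := by
  have := H.lint k hS (u := fun _ => 1) measurable_const
  simpa using this

/-- The weights are positive, finite and multiplicative on `Z`. -/
structure Coc [MeasurableSpace X] (μ : Measure X) (g h : ℕ → X → X) (Z : Set X) : Prop where
  fin : ∀ k, ∀ x ∈ Z, wf μ (g k) (h k) x ≠ ⊤
  pos : ∀ k, ∀ x ∈ Z, h k (g k x) = x → wf μ (g k) (h k) x ≠ 0
  chain : ∀ k l m, ∀ x ∈ Z, h k (g k x) = x → h l (g l (g k x)) = g k x → h m (g m x) = x →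
    g m x = g l (g k x) → wf μ (g m) (h m) x = wf μ (g l) (h l) (g k x) * wf μ (g k) (h k) x

theorem coc_exists [MeasurableSpace X] [StandardBorelSpace X] {μ : Measure X} [IsFiniteMeasure μ]
    {E : Set (X × X)} {g h : ℕ → X → X} {Z : Set X} (H : Sys μ E g h Z) :
    ∃ Z', Sys μ E g h Z' ∧ Coc μ g h Z' := by
  have hDm : ∀ k, MeasurableSet {x | h k (g k x) = x} := fun k =>
    measurableSet_eq_fun ((H.hm k).comp (H.gm k)) measurable_id
  have hRm : ∀ k, MeasurableSet {y | g k (h k y) = y} := fun k =>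
    measurableSet_eq_fun ((H.gm k).comp (H.hm k)) measurable_id
  have h1 : ∀ k, ∀ᵐ x ∂μ, wf μ (g k) (h k) x ≠ ⊤ := fun k => Measure.rnDeriv_ne_top _ _
  have h2 : ∀ k, ∀ᵐ x ∂μ, h k (g k x) = x → wf μ (g k) (h k) x ≠ 0 := by
    intro k
    let S : Set X := {x | h k (g k x) = x} ∩ wf μ (g k) (h k) ⁻¹' {0}
    have hS : MeasurableSet S := (hDm k).inter (wf_meas _ _ _ (measurableSet_singleton 0))
    have h0 : μ ({y | g k (h k y) = y} ∩ h k ⁻¹' S) = 0 := by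
      rw [← H.lint_one k hS]
      rw [setLIntegral_congr_fun (g := fun _ => 0) hS (fun x hx => hx.2)]
      simp
    have hS0 : μ S = 0 := by
      refine measure_mono_null ?_ (H.null _ h0)
      intro x hx
      have hx1 : h k (g k x) = x := hx.1
      refine ⟨g k x, ⟨?_, ?_⟩, H.gE k x⟩
      · change g k (h k (g k x)) = g k x
        rw [hx1]
      · change h k (g k x) ∈ S
        rw [hx1]; exact hx
    filter_upwards [measure_eq_zero_iff_ae_notMem.1 hS0] with x hx hx1 hx2
    exact hx ⟨hx1, hx2⟩
  have h3 : ∀ k l m, ∀ᵐ x ∂μ, h k (g k x) = x → h l (g l (g k x)) = g k x → h m (g m x) = x →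
    g m x = g l (g k x) → wf μ (g m) (h m) x = wf μ (g l) (h l) (g k x) * wf μ (g k) (h k) x := by
    intro k l m
    let S : Set X := {x | h k (g k x) = x} ∩ (g k ⁻¹' {x | h l (g l x) = x}) ∩
      {x | h m (g m x) = x} ∩ {x | g m x = g l (g k x)}
    have hS : MeasurableSet S := (((hDm k).inter (H.gm k (hDm l))).inter (hDm m)).inter
      (measurableSet_eq_fun (H.gm m) ((H.gm l).comp (H.gm k)))
    have key : wf μ (g m) (h m) =ᵐ[μ.restrict S]
        fun x => wf μ (g l) (h l) (g k x) * wf μ (g k) (h k) x := by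
      refine ae_eq_of_forall_setLIntegral_eq_of_sigmaFinite (wf_meas _ _ _)
        (((wf_meas _ _ _).comp (H.gm k)).mul (wf_meas _ _ _)) fun C hC _ => ?_
      rw [Measure.restrict_restrict hC, H.lint_one m (hC.inter hS),
        H.lint k (hC.inter hS) (wf_meas _ _ _),
        H.lint_one l ((hRm k).inter
          (H.hm k (hC.inter hS)))]
      congr 1
      ext z
      constructor
      · rintro ⟨hz, hzC, hzS⟩
        have hz' : g m (h m z) = z := hz
        obtain ⟨⟨⟨a1, a2⟩, a3⟩, a4⟩ := hzS
        have a1' : h k (g k (h m z)) = h m z := a1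
        have a2' : h l (g l (g k (h m z))) = g k (h m z) := a2
        have a4' : g m (h m z) = g l (g k (h m z)) := a4
        rw [hz'] at a4'
        rw [← a4'] at a2'
        refine ⟨?_, ?_, ?_⟩
        · change g l (h l z) = z
          rw [a2', ← a4']
        · change g k (h k (h l z)) = h l z
          rw [a2', a1']
        · change h k (h l z) ∈ C ∩ S
          rw [a2', a1']
          exact ⟨hzC, ⟨⟨⟨a1, a2⟩, a3⟩, a4⟩⟩
      · rintro ⟨hz, hz2, hzC, hzS⟩
        have hz' : g l (h l z) = z := hz
        have hz2' : g k (h k (h l z)) = h l z := hz2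
        obtain ⟨⟨⟨a1, a2⟩, a3⟩, a4⟩ := hzS
        have a3' : h m (g m (h k (h l z))) = h k (h l z) := a3
        have a4' : g m (h k (h l z)) = g l (g k (h k (h l z))) := a4
        rw [hz2', hz'] at a4'
        rw [a4'] at a3'
        refine ⟨?_, ?_⟩
        · change g m (h m z) = z
          rw [a3', a4']
        · change h m z ∈ C ∩ S
          rw [a3']
          exact ⟨hzC, ⟨⟨⟨a1, a2⟩, a3⟩, a4⟩⟩
    filter_upwards [(ae_restrict_iff' hS).1 key] with x hx b1 b2 b3 b4
    exact hx ⟨⟨⟨b1, b2⟩, b3⟩, b4⟩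
  have hall := (ae_all_iff.2 h1).and ((ae_all_iff.2 h2).and
    (ae_all_iff.2 fun k => ae_all_iff.2 fun l => ae_all_iff.2 fun m => h3 k l m))
  have hall2 := hall.and (mem_ae_iff.2 H.Z0 : ∀ᵐ x ∂μ, x ∈ Z)
  obtain ⟨Z', hm, h0, hN, hinv⟩ := null_inv μ E H.null _ (ae_iff.1 hall2)
  have hZ' : ∀ x ∈ Z', _ := fun x hx => not_not.1 (hN x hx)
  exact ⟨Z', ⟨H.eqv, H.null, H.gm, H.hm, H.gE, H.hE, hm, h0, hinv,
    fun x hx => H.cover x (hZ' x hx).2⟩,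
    ⟨fun k x hx => (hZ' x hx).1.1 k, fun k x hx => (hZ' x hx).1.2.1 k,
      fun k l m x hx => (hZ' x hx).1.2.2 k l m⟩⟩

open Classical in
/-- The density of the invariant measure normalised by the set `D`. -/
def dens [MeasurableSpace X] (μ : Measure X) (g h : ℕ → X → X) (D : Set X) (x : X) : ℝ≥0∞ :=
  ⨅ k, if h k (g k x) = x ∧ g k x ∈ D then wf μ (g k) (h k) x else ⊤

theorem dens_meas [MeasurableSpace X] [StandardBorelSpace X] {μ : Measure X}
    {E : Set (X × X)} {g h : ℕ → X → X} {Z : Set X} (H : Sys μ E g h Z) {D : Set X}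
    (hD : MeasurableSet D) : Measurable (dens μ g h D) := by
  refine Measurable.iInf fun k => Measurable.ite ?_ (wf_meas _ _ _) measurable_const
  exact (measurableSet_eq_fun ((H.hm k).comp (H.gm k)) measurable_id).inter (H.gm k hD)

theorem dens_le [MeasurableSpace X] {μ : Measure X} {g h : ℕ → X → X} {D : Set X} {x : X} (k : ℕ)
    (h1 : h k (g k x) = x) (h2 : g k x ∈ D) : dens μ g h D x ≤ wf μ (g k) (h k) x := by
  refine (iInf_le _ k).trans ?_
  rw [if_pos ⟨h1, h2⟩]

theorem le_dens [MeasurableSpace X] {μ : Measure X} {g h : ℕ → X → X} {D : Set X} {x : X}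
    {c : ℝ≥0∞} (H : ∀ k, h k (g k x) = x → g k x ∈ D → c ≤ wf μ (g k) (h k) x) :
    c ≤ dens μ g h D x := by
  refine le_iInf fun k => ?_
  split_ifs with hk
  · exact H k hk.1 hk.2
  · exact le_top

theorem dens_scale [MeasurableSpace X] {μ : Measure X}
    {E : Set (X × X)} {g h : ℕ → X → X} {Z : Set X} (H : Sys μ E g h Z) (HC : Coc μ g h Z)
    {D : Set X} (k : ℕ) (x : X) (hx : x ∈ Z) (hk : h k (g k x) = x) :
    dens μ g h D x = dens μ g h D (g k x) * wf μ (g k) (h k) x := by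
  have hy : g k x ∈ Z := H.Zinv _ _ hx (H.gE k x)
  apply le_antisymm
  · rw [← ENNReal.div_le_iff (HC.pos k x hx hk) (HC.fin k x hx)]
    refine le_dens fun l hl hlD => ?_
    rw [ENNReal.div_le_iff (HC.pos k x hx hk) (HC.fin k x hx)]
    obtain ⟨m, hm1, hm2⟩ := H.cover x hx (g l (g k x)) (H.eqv.trans (H.gE k x) (H.gE l _))
    have hm3 : h m (g m x) = x := by rw [hm1, hm2]
    rw [← HC.chain k l m x hx hk hl hm3 hm1]
    exact dens_le m hm3 (hm1 ▸ hlD)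
  · refine le_dens fun m hm hmD => ?_
    obtain ⟨l, hl1, hl2⟩ := H.cover _ hy (g m x) (H.eqv.trans (H.eqv.symm (H.gE k x)) (H.gE m _))
    have hl3 : h l (g l (g k x)) = g k x := by rw [hl1, hl2]
    rw [HC.chain k l m x hx hk hl3 hm hl1.symm]
    gcongr
    exact dens_le l hl3 (hl1 ▸ hmD)

theorem dens_invariant [MeasurableSpace X] [StandardBorelSpace X] {μ : Measure X}
    [IsFiniteMeasure μ]
    {E : Set (X × X)} {g h : ℕ → X → X} {Z : Set X} (H : Sys μ E g h Z) (HC : Coc μ g h Z)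
    {D : Set X} (hD : MeasurableSet D) : InvariantUnder (μ.withDensity (dens μ g h D)) E := by
  intro f A hf hA hinj hfE
  set d := dens μ g h D with hd
  have hdm : Measurable d := dens_meas H hD
  set ν := μ.withDensity d
  have hνac : ν ≪ μ := withDensity_absolutelyContinuous _ _
  have hfA : MeasurableSet (f '' A) := hA.image_of_measurable_injOn hf hinj
  -- the key claim
  have key : ∀ B ⊆ A, MeasurableSet B → ν B = ν (f '' B) := by
    intro B hBA hB
    let P : ℕ → Set X := fun k => {x | g k x = f x} ∩ {x | h k (f x) = x}
    have hP : ∀ k, MeasurableSet (P k) := fun k =>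
      (measurableSet_eq_fun (H.gm k) hf).inter (measurableSet_eq_fun ((H.hm k).comp hf) measurable_id)
    let Bk : ℕ → Set X := fun k => (B ∩ Z) ∩ disjointed P k
    have hBkm : ∀ k, MeasurableSet (Bk k) := fun k =>
      (hB.inter H.Zm).inter (MeasurableSet.disjointed hP k)
    have hBkd : Pairwise (Function.onFun Disjoint Bk) := fun i j hij =>
      (disjoint_disjointed P hij).mono inter_subset_right inter_subset_right
    have hBkA : ∀ k, Bk k ⊆ A := fun k x hx => hBA hx.1.1
    have hU : ⋃ k, Bk k = B ∩ Z := by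
      rw [← inter_iUnion, iUnion_disjointed]
      refine inter_eq_left.2 fun x hx => ?_
      obtain ⟨k, h1, h2⟩ := H.cover x hx.2 (f x) (hfE x (hBA hx.1))
      exact mem_iUnion.2 ⟨k, h1, h2⟩
    have hone : ∀ k, ν (Bk k) = ν (f '' Bk k) := by
      intro k
      have himm : MeasurableSet (f '' Bk k) :=
        (hBkm k).image_of_measurable_injOn hf (hinj.mono (hBkA k))
      rw [withDensity_apply _ (hBkm k), withDensity_apply _ himm]
      have hprop : ∀ x ∈ Bk k, g k x = f x ∧ h k (f x) = x := fun x hx =>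
        disjointed_subset P k hx.2
      have e1 : ∫⁻ x in Bk k, d x ∂μ = ∫⁻ x in Bk k, d (g k x) * wf μ (g k) (h k) x ∂μ := by
        refine setLIntegral_congr_fun (hBkm k) fun x hx => ?_
        obtain ⟨p1, p2⟩ := hprop x hx
        exact dens_scale H HC k x hx.1.2 (by rw [p1, p2])
      rw [e1, H.lint k (hBkm k) hdm]
      congr 2
      ext y
      constructor
      · rintro ⟨h1, h2⟩
        refine ⟨h k y, h2, ?_⟩
        rw [← (hprop _ h2).1]
        exact h1
      · rintro ⟨x, hx, rfl⟩
        obtain ⟨p1, p2⟩ := hprop x hx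
        refine ⟨?_, ?_⟩
        · change g k (h k (f x)) = f x
          rw [p2, p1]
        · change h k (f x) ∈ Bk k
          rw [p2]; exact hx
    have c1 : ν B = ν (B ∩ Z) := by
      refine (measure_inter_conull' ?_).symm
      exact hνac (measure_mono_null (fun x hx => hx.2) H.Z0)
    have c2 : ν (f '' B) = ν (f '' (B ∩ Z)) := by
      refine le_antisymm ?_ (measure_mono (image_mono inter_subset_left))
      have : f '' B ⊆ f '' (B ∩ Z) ∪ Zᶜ := by
        rintro _ ⟨x, hx, rfl⟩
        by_cases hz : x ∈ Z
        · exact Or.inl ⟨x, ⟨hx, hz⟩, rfl⟩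
        · exact Or.inr fun hz' => hz (H.Zinv _ _ hz' (H.eqv.symm (hfE x (hBA hx))))
      refine (measure_mono this).trans ((measure_union_le _ _).trans ?_)
      rw [hνac H.Z0, add_zero]
    rw [c1, c2, ← hU, image_iUnion, measure_iUnion hBkd hBkm, measure_iUnion]
    · exact tsum_congr hone
    · intro i j hij
      refine disjoint_left.2 ?_
      rintro _ ⟨x, hx, rfl⟩ ⟨y, hy, hxy⟩
      have := hinj (hBkA j hy) (hBkA i hx) hxy
      subst this
      exact disjoint_left.1 (hBkd hij) hx hy
    · exact fun k => (hBkm k).image_of_measurable_injOn hf (hinj.mono (hBkA k))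
  ext T hT
  rw [Measure.map_apply hf hT, Measure.restrict_apply (hf hT), Measure.restrict_apply hT,
    key _ inter_subset_right ((hf hT).inter hA)]
  congr 1
  ext y
  constructor
  · rintro ⟨x, ⟨h1, h2⟩, rfl⟩
    exact ⟨h1, x, h2, rfl⟩
  · rintro ⟨h1, x, h2, rfl⟩
    exact ⟨x, ⟨h1, h2⟩, rfl⟩

theorem no_type_III [MeasurableSpace X] [StandardBorelSpace X] {μ : Measure X}
    [IsFiniteMeasure μ]
    {E : Set (X × X)} {g h : ℕ → X → X} {Z : Set X} (H : Sys μ E g h Z) (HC : Coc μ g h Z)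
    (herg : ErgodicRel μ E)
    {D R : Set X} (hD : MeasurableSet D) (hR : MeasurableSet R) (hD0 : μ D ≠ 0) (hR0 : μ R ≠ 0)
    (ε : ℝ≥0∞) (hε : ε ≠ 0)
    (hDR : ∀ x ∈ R, x ∈ Z → ∀ k, h k (g k x) = x → g k x ∈ D → ε ≤ wf μ (g k) (h k) x) :
    ¬ IsTypeIII μ E := by
  have hZ : ∀ᵐ x ∂μ, x ∈ Z := mem_ae_iff.2 H.Z0
  have hDs : ∀ᵐ x ∂μ, x ∈ ESat E D := mem_ae_iff.2 (herg D hD hD0)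
  have hRs : ∀ᵐ x ∂μ, x ∈ ESat E R := mem_ae_iff.2 (herg R hR hR0)
  have hfin : ∀ᵐ x ∂μ, dens μ g h D x ≠ ⊤ := by
    filter_upwards [hZ, hDs] with x hx ⟨y, hy, hxy⟩
    obtain ⟨k, h1, h2⟩ := H.cover x hx y hxy
    exact ne_top_of_le_ne_top (HC.fin k x hx) (dens_le k (by rw [h1, h2]) (h1 ▸ hy))
  have hpos : ∀ᵐ x ∂μ, dens μ g h D x ≠ 0 := by
    filter_upwards [hZ, hRs] with x hx ⟨y, hy, hxy⟩
    obtain ⟨k, h1, h2⟩ := H.cover x hx y hxy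
    have h3 : h k (g k x) = x := by rw [h1, h2]
    rw [dens_scale H HC k x hx h3]
    refine mul_ne_zero ?_ (HC.pos k x hx h3)
    rw [h1]
    have : ε ≤ dens μ g h D y := le_dens (hDR y hy (H.Zinv _ _ hx hxy))
    exact (lt_of_lt_of_le (pos_iff_ne_zero.2 hε) this).ne'
  intro hIII
  exact hIII ⟨μ.withDensity (dens μ g h D), SigmaFinite.withDensity_of_ne_top hfin,
    ⟨withDensity_absolutelyContinuous _ _,
      withDensity_absolutelyContinuous' (dens_meas H hD).aemeasurable hpos⟩,
    dens_invariant H HC hD⟩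

theorem compress [MeasurableSpace X] [StandardBorelSpace X] {μ : Measure X}
    [IsFiniteMeasure μ]
    {E : Set (X × X)} {g h : ℕ → X → X} {Z : Set X} (H : Sys μ E g h Z) (HC : Coc μ g h Z)
    (herg : ErgodicRel μ E) (hIII : IsTypeIII μ E) {A : Set X} (hA : MeasurableSet A)
    (hA0 : μ A ≠ 0) :
    ∃ (F : X → X) (U : Set X), Measurable F ∧ MeasurableSet U ∧ μ Uᶜ = 0 ∧ InjOn F U ∧
      (∀ x ∈ U, F x ∈ A) ∧ ∀ x ∈ U, (x, F x) ∈ E := by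
  obtain ⟨ε, hε, hεA⟩ := ENNReal.exists_nnreal_pos_mul_lt (measure_ne_top μ univ) hA0
  have hDm : ∀ k, MeasurableSet {x | h k (g k x) = x} := fun k =>
    measurableSet_eq_fun ((H.hm k).comp (H.gm k)) measurable_id
  have hRm : ∀ k, MeasurableSet {y | g k (h k y) = y} := fun k =>
    measurableSet_eq_fun ((H.gm k).comp (H.hm k)) measurable_id
  let C : ℕ → Set X × Set X → Set X := fun k S =>
    S.1ᶜ ∩ {x | h k (g k x) = x} ∩ g k ⁻¹' (A \ S.2) ∩ wf μ (g k) (h k) ⁻¹' (Iic (ε : ℝ≥0∞))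
  let T : ℕ → Set X × Set X := fun k => Nat.rec (∅, ∅) (fun k S =>
    (S.1 ∪ C k S, S.2 ∪ ({y | g k (h k y) = y} ∩ h k ⁻¹' (C k S)))) k
  have hT1 : ∀ k, (T (k+1)).1 = (T k).1 ∪ C k (T k) := fun k => rfl
  have hT2 : ∀ k, (T (k+1)).2 = (T k).2 ∪ ({y | g k (h k y) = y} ∩ h k ⁻¹' (C k (T k))) :=
    fun k => rfl
  have hCm' : ∀ k, MeasurableSet (T k).1 → MeasurableSet (T k).2 → MeasurableSet (C k (T k)) :=
    fun k h1 h2 => ((h1.compl.inter (hDm k)).inter (H.gm k (hA.diff h2))).inter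
      (wf_meas _ _ _ measurableSet_Iic)
  have hTm : ∀ k, MeasurableSet (T k).1 ∧ MeasurableSet (T k).2 := by
    intro k
    induction k with
    | zero => exact ⟨MeasurableSet.empty, MeasurableSet.empty⟩
    | succ k ih =>
      have := hCm' k ih.1 ih.2
      rw [hT1, hT2]
      exact ⟨ih.1.union this, ih.2.union ((hRm k).inter (H.hm k this))⟩
  have hCm : ∀ k, MeasurableSet (C k (T k)) := fun k => hCm' k (hTm k).1 (hTm k).2
  have hmono1 : Monotone fun k => (T k).1 :=
    monotone_nat_of_le_succ fun k => by rw [hT1]; exact subset_union_left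
  have hmono2 : Monotone fun k => (T k).2 :=
    monotone_nat_of_le_succ fun k => by rw [hT2]; exact subset_union_left
  have hmeas : ∀ k, μ (T k).2 ≤ ε * μ (T k).1 := by
    intro k
    induction k with
    | zero => simp [T]
    | succ k ih =>
      have hdisj : Disjoint (T k).1 (C k (T k)) :=
        disjoint_left.2 fun x hx hx2 => hx2.1.1.1 hx
      rw [hT1, hT2, measure_union hdisj (hCm k), mul_add]
      refine (measure_union_le _ _).trans (add_le_add ih ?_)
      rw [← H.lint_one k (hCm k)]
      calc ∫⁻ x in C k (T k), wf μ (g k) (h k) x ∂μ ≤ ∫⁻ x in C k (T k), (ε : ℝ≥0∞) ∂μ :=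
            setLIntegral_mono measurable_const fun x hx => hx.2
        _ = ε * μ (C k (T k)) := by simp
  have himg : ∀ k, ∀ x ∈ C k (T k), g k x ∈ (T (k+1)).2 := by
    intro k x hx
    have hx1 : h k (g k x) = x := hx.1.1.2
    rw [hT2]
    refine Or.inr ⟨?_, ?_⟩
    · change g k (h k (g k x)) = g k x
      rw [hx1]
    · change h k (g k x) ∈ C k (T k)
      rw [hx1]; exact hx
  have hCd : ∀ i j, i < j → ∀ x ∈ C i (T i), x ∉ C j (T j) := by
    intro i j hij x hx hx2
    apply hx2.1.1.1
    apply hmono1 (Nat.succ_le_of_lt hij)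
    change x ∈ (T (i+1)).1
    rw [hT1]
    exact Or.inr hx
  have hinj : ∀ i j, i < j → ∀ x ∈ C i (T i), ∀ y ∈ C j (T j), g i x ≠ g j y := by
    intro i j hij x hx y hy hxy
    apply hy.1.2.2
    rw [← hxy]
    exact hmono2 (Nat.succ_le_of_lt hij) (himg i x hx)
  obtain ⟨F, hF, hFC⟩ := exists_measurable_piecewise (fun k => C k (T k)) hCm g H.gm (by
    intro i j hij x hx
    exfalso
    rcases lt_or_gt_of_ne hij with hlt | hlt
    · exact hCd i j hlt x hx.1 hx.2
    · exact hCd j i hlt x hx.2 hx.1)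
  let U : Set X := ⋃ k, C k (T k)
  have hU : MeasurableSet U := MeasurableSet.iUnion hCm
  refine ⟨F, U, hF, hU, ?_, ?_, ?_, ?_⟩
  · by_contra hR0
    let V : Set X := ⋃ k, (T k).2
    have hV : MeasurableSet V := MeasurableSet.iUnion fun k => (hTm k).2
    have hVA : μ V < μ A := by
      refine lt_of_le_of_lt ?_ hεA
      rw [hmono2.measure_iUnion]
      exact iSup_le fun k => (hmeas k).trans (by gcongr; exact subset_univ _)
    have hD0 : μ (A \ V) ≠ 0 := by
      intro h0
      have h1 : μ A ≤ μ (A \ V) + μ V :=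
        (measure_mono (by rw [sdiff_union_self]; exact subset_union_left)).trans
          (measure_union_le (A \ V) V)
      rw [h0, zero_add] at h1
      exact absurd hVA (not_lt.2 h1)
    refine no_type_III H HC herg (hA.diff hV) hU.compl hD0 hR0 ε (by exact_mod_cast hε.ne') ?_ hIII
    intro x hx _ k hk hkD
    by_contra hlt
    push Not at hlt
    apply hx
    refine mem_iUnion.2 ⟨k, ⟨⟨?_, hk⟩, hkD.1, fun hv => hkD.2 (mem_iUnion.2 ⟨k, hv⟩)⟩, hlt.le⟩
    intro hxT
    apply hx
    have : ∀ k, x ∈ (T k).1 → x ∈ U := by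
      intro k
      induction k with
      | zero => intro h; exact absurd h (notMem_empty x)
      | succ k ih =>
        intro h
        rw [hT1] at h
        rcases h with h | h
        exacts [ih h, mem_iUnion.2 ⟨k, h⟩]
    exact this k hxT
  · intro x hx y hy hxy
    obtain ⟨i, hi⟩ := mem_iUnion.1 hx
    obtain ⟨j, hj⟩ := mem_iUnion.1 hy
    rw [hFC i hi, hFC j hj] at hxy
    rcases lt_trichotomy i j with hij | rfl | hij
    · exact absurd hxy (hinj i j hij x hi y hj)
    · have h1 : h i (g i x) = x := hi.1.1.2
      have h2 : h i (g i y) = y := hj.1.1.2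
      rw [← h1, ← h2, hxy]
    · exact absurd hxy.symm (hinj j i hij y hj x hi)
  · intro x hx
    obtain ⟨i, hi⟩ := mem_iUnion.1 hx
    rw [hFC i hi]
    exact hi.1.2.1
  · intro x hx
    obtain ⟨i, hi⟩ := mem_iUnion.1 hx
    rw [hFC i hi]
    exact H.gE i x

/-- Schroeder-Bernstein step. -/
theorem sb_step [MeasurableSpace X] [StandardBorelSpace X] (E : Set (X × X))
    (hrefl : ∀ x, (x, x) ∈ E) (F : X → X) (hF : Measurable F) (W A : Set X)
    (hW : MeasurableSet W) (hA : MeasurableSet A) (hinj : InjOn F W) (hFA : ∀ x ∈ W, F x ∈ A)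
    (hFW : ∀ x ∈ W, F x ∈ W) (hFE : ∀ x ∈ W, (x, F x) ∈ E) :
    ∃ f : X → X, Measurable f ∧ BijOn f W (W ∩ A) ∧ ∀ x ∈ W, (x, f x) ∈ E := by
  let S : ℕ → Set X := fun k => Nat.rec (W \ A) (fun _ s => F '' s) k
  have hS : ∀ k, MeasurableSet (S k) ∧ S k ⊆ W := by
    intro k
    induction k with
    | zero => exact ⟨hW.diff hA, sdiff_subset⟩
    | succ k ih =>
      refine ⟨ih.1.image_of_measurable_injOn hF (hinj.mono ih.2), ?_⟩
      rintro _ ⟨x, hx, rfl⟩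
      exact hFW x (ih.2 hx)
  let T : Set X := ⋃ k, S k
  have hT : MeasurableSet T := MeasurableSet.iUnion fun k => (hS k).1
  have hTF : ∀ x ∈ T, F x ∈ T := by
    intro x hx
    obtain ⟨k, hk⟩ := mem_iUnion.1 hx
    exact mem_iUnion.2 ⟨k + 1, x, hk, rfl⟩
  classical
  refine ⟨T.piecewise F id, hF.piecewise hT measurable_id, ⟨?_, ?_, ?_⟩, ?_⟩
  · intro x hx
    by_cases hxT : x ∈ T
    · rw [piecewise_eq_of_mem _ _ _ hxT]
      exact ⟨hFW x hx, hFA x hx⟩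
    · rw [piecewise_eq_of_notMem _ _ _ hxT]
      refine ⟨hx, ?_⟩
      by_contra hxA
      exact hxT (mem_iUnion.2 ⟨0, hx, hxA⟩)
  · intro x hx y hy hxy
    by_cases hxT : x ∈ T <;> by_cases hyT : y ∈ T
    · rw [piecewise_eq_of_mem _ _ _ hxT, piecewise_eq_of_mem _ _ _ hyT] at hxy
      exact hinj hx hy hxy
    · rw [piecewise_eq_of_mem _ _ _ hxT, piecewise_eq_of_notMem _ _ _ hyT] at hxy
      have hxy2 : F x = y := hxy
      exact absurd (hxy2 ▸ hTF x hxT) hyT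
    · rw [piecewise_eq_of_notMem _ _ _ hxT, piecewise_eq_of_mem _ _ _ hyT] at hxy
      have hxy2 : x = F y := hxy
      exact absurd (by rw [hxy2]; exact hTF y hyT) hxT
    · rw [piecewise_eq_of_notMem _ _ _ hxT, piecewise_eq_of_notMem _ _ _ hyT] at hxy
      exact hxy
  · rintro y ⟨hyW, hyA⟩
    by_cases hyT : y ∈ T
    · obtain ⟨k, hk⟩ := mem_iUnion.1 hyT
      cases k with
      | zero => exact absurd hyA hk.2
      | succ k =>
        obtain ⟨x, hx, rfl⟩ := hk
        refine ⟨x, (hS k).2 hx, ?_⟩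
        rw [piecewise_eq_of_mem _ _ _ (mem_iUnion.2 ⟨k, hx⟩ : x ∈ T)]
    · exact ⟨y, hyW, by rw [piecewise_eq_of_notMem _ _ _ hyT]; rfl⟩
  · intro x hx
    by_cases hxT : x ∈ T
    · rw [piecewise_eq_of_mem _ _ _ hxT]
      exact hFE x hx
    · rw [piecewise_eq_of_notMem _ _ _ hxT]
      exact hrefl x

/-- A properly ergodic mcp type III CBER is isomorphic to its restriction
to any non-null Borel set `A`: there is a Borel bijection from a conull subset of `X` onto
a conull (in `A`) subset of `A`, preserving the measure class and the relation. -/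
theorem typeIII_isomorphic_to_restriction {X : Type*} [MeasurableSpace X]
    [StandardBorelSpace X]
    (μ : Measure X) [SigmaFinite μ]
    (E : Set (X × X)) (hE : IsCBER E) (hmcp : MCP μ E)
    (hpe : ProperlyErgodicRel μ E) (hIII : IsTypeIII μ E)
    (A : Set X) (hA : MeasurableSet A) (hAnn : μ A ≠ 0) :
    ∃ f : X → X, Measurable f ∧
      ∃ X' A' : Set X, MeasurableSet X' ∧ MeasurableSet A' ∧
        μ X'ᶜ = 0 ∧ A' ⊆ A ∧ μ (A \ A') = 0 ∧
        Set.BijOn f X' A' ∧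
        Measure.map f (μ.restrict X') ≪ μ.restrict A ∧
        μ.restrict A ≪ Measure.map f (μ.restrict X') ∧
        ∀ x ∈ X', ∀ y ∈ X', ((x, y) ∈ E ↔ (f x, f y) ∈ E) := by
  have hac1 : μ ≪ μ.toFinite := absolutelyContinuous_toFinite μ
  have hac2 : μ.toFinite ≪ μ := toFinite_absolutelyContinuous μ
  have hnull : ∀ N, μ N = 0 → μ (ESat E N) = 0 := esat_null μ E hE.1 hmcp
  obtain ⟨g, h, Z0, H0⟩ := sys_exists μ.toFinite E hE (fun N hN => hac2 (hnull N (hac1 hN)))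
  obtain ⟨Z, H, HC⟩ := coc_exists H0
  obtain ⟨F, U, hF, hU, hU0, hinj, hFA, hFE⟩ := compress H HC
    (fun B hB hB0 => hac2 (hpe.1 B hB fun h0 => hB0 (hac2 h0)))
    (fun ⟨μ', h1, h2, h3⟩ => hIII ⟨μ', h1, ⟨h2.1.trans hac2, hac1.trans h2.2⟩, h3⟩) hA
    (fun h0 => hAnn (hac1 h0))
  obtain ⟨W, hW, hW0, hWU, hWinv⟩ := null_inv μ E hnull Uᶜ (hac1 hU0)
  have hWU' : W ⊆ U := fun x hx => not_not.1 (hWU x hx)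
  obtain ⟨f, hf, hbij, hfE⟩ := sb_step E hE.2.1.refl F hF W A hW hA (hinj.mono hWU')
    (fun x hx => hFA x (hWU' hx)) (fun x hx => hWinv x _ hx (hFE x (hWU' hx)))
    (fun x hx => hFE x (hWU' hx))
  refine ⟨f, hf, W, W ∩ A, hW, hW.inter hA, hW0, inter_subset_right, ?_, hbij, ?_, ?_, ?_⟩
  · exact measure_mono_null (fun x hx hxW => hx.2 ⟨hxW, hx.1⟩) hW0
  · refine Measure.AbsolutelyContinuous.mk fun N hN hN0 => ?_
    rw [Measure.restrict_apply hN] at hN0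
    rw [Measure.map_apply hf hN, Measure.restrict_apply (hf hN)]
    refine measure_mono_null ?_ (hnull _ hN0)
    rintro x ⟨hx, hxW⟩
    exact ⟨f x, ⟨hx, (hbij.1 hxW).2⟩, hfE x hxW⟩
  · refine Measure.AbsolutelyContinuous.mk fun N hN hN0 => ?_
    rw [Measure.map_apply hf hN, Measure.restrict_apply (hf hN)] at hN0
    rw [Measure.restrict_apply hN]
    refine measure_mono_null ?_ (measure_union_null (hnull _ hN0) hW0)
    rintro y ⟨hy, hyA⟩
    by_cases hyW : y ∈ W
    · obtain ⟨x, hx, rfl⟩ := hbij.2.2 ⟨hyW, hyA⟩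
      exact Or.inl ⟨x, ⟨hy, hx⟩, hE.2.1.symm (hfE x hx)⟩
    · exact Or.inr hyW
  · intro x hx y hy
    exact ⟨fun hxy => hE.2.1.trans (hE.2.1.symm (hfE x hx)) (hE.2.1.trans hxy (hfE y hy)),
      fun hxy => hE.2.1.trans (hfE x hx) (hE.2.1.trans hxy (hE.2.1.symm (hfE y hy)))⟩
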